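/- Second linear-system equation for the endpoint derivatives: with β₊ = 1 + (h/3)·g₊ + (h²/9)·g₀·g₊ and β₋ = 1 − (h/3)·g₋ + (h²/9)·g₀·g₋, as h → 0 the quantity β₊·y'₊ − β₋·y'₋ − (2/3)·g₀·(y₋ − y₊) + (h/3)·(4·f₀·y₀ + f₊·y₊ + f₋·y₋) − (h²/9)·g₀·(f₋·y₋ − f₊·y₊) + (7h⁵/270)·g₀·y⁽⁵⁾₀ + (h⁵/90)·y⁽⁶⁾₀, viewed as a function of h, is O(h⁷). -/

import Mathlib

open Asymptotics Filter Topology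

/-- Taylor's theorem with a big-O remainder for a function of class `C^n` on an open interval. -/
theorem taylor_isBigO_of_contDiffOn_Ioo {u : ℝ → ℝ} {x lo hi : ℝ} {n : ℕ}
    (hx : x ∈ Set.Ioo lo hi) (hu : ContDiffOn ℝ n u (Set.Ioo lo hi)) :
    (fun h : ℝ => u (x + h) - ∑ k ∈ Finset.range n, iteratedDeriv k u x / k.factorial * h ^ k)
      =O[𝓝 0] (fun h : ℝ => h ^ n) := by
  have hT := (taylor_isLittleO (convex_Ioo lo hi) hx hu).isBigO
  rw [isOpen_Ioo.nhdsWithin_eq hx] at hT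
  have hadd : Tendsto (fun h : ℝ => x + h) (𝓝 0) (𝓝 x) := by
    simpa using (continuous_const_add x).tendsto 0
  have hT' : (fun h : ℝ => u (x + h) - taylorWithinEval u n (Set.Ioo lo hi) x (x + h))
      =O[𝓝 0] (fun h : ℝ => h ^ n) :=
    (hT.comp_tendsto hadd).congr_right fun h => by simp
  have hlast : (fun h : ℝ => iteratedDeriv n u x / n.factorial * h ^ n)
      =O[𝓝 0] (fun h : ℝ => h ^ n) := (isBigO_refl _ _).const_mul_left _
  refine (hT'.add hlast).congr_left fun h => ?_
  have hcoeff (k : ℕ) : iteratedDerivWithin k u (Set.Ioo lo hi) x = iteratedDeriv k u x :=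
    iteratedDerivWithin_of_isOpen isOpen_Ioo hx
  simp only [taylor_within_apply, hcoeff, add_sub_cancel_left, smul_eq_mul,
    Finset.sum_range_succ _ n]
  have hsum : ∑ k ∈ Finset.range n, ((k.factorial : ℝ)⁻¹ * h ^ k) * iteratedDeriv k u x
      = ∑ k ∈ Finset.range n, iteratedDeriv k u x / k.factorial * h ^ k :=
    Finset.sum_congr rfl fun k _ => by ring
  rw [hsum]
  ring

/-- Pulling a big-O estimate in powers of `h` back along `h ↦ -h`. -/
theorem isBigO_pow_comp_neg {r : ℝ → ℝ} {n : ℕ} (hr : r =O[𝓝 0] (fun h : ℝ => h ^ n)) :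
    (fun h : ℝ => r (-h)) =O[𝓝 0] (fun h : ℝ => h ^ n) := by
  have hneg : Tendsto (fun h : ℝ => -h) (𝓝 0) (𝓝 0) := by
    simpa using (continuous_neg (G := ℝ)).tendsto 0
  refine (hr.comp_tendsto hneg).trans (IsBigO.of_norm_left ?_)
  simpa [Function.comp_def] using (isBigO_refl (fun h : ℝ => h ^ n) (𝓝 0)).norm_left

theorem second_linear_system_equation
    (x₀ lo hi : ℝ) (y g f : ℝ → ℝ)
    (hx : x₀ ∈ Set.Ioo lo hi)
    (hy : ContDiffOn ℝ 8 y (Set.Ioo lo hi))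
    (hg : ContDiffOn ℝ 8 g (Set.Ioo lo hi))
    (hf : ContDiffOn ℝ 8 f (Set.Ioo lo hi))
    (hode : ∀ x ∈ Set.Ioo lo hi,
      deriv (deriv y) x + g x * deriv y x + f x * y x = 0) :
    (fun h : ℝ =>
      (1 + (h / 3) * g (x₀ + h) + (h ^ 2 / 9) * g x₀ * g (x₀ + h)) * deriv y (x₀ + h)
        - (1 - (h / 3) * g (x₀ - h) + (h ^ 2 / 9) * g x₀ * g (x₀ - h)) * deriv y (x₀ - h)
        - (2 / 3) * g x₀ * (y (x₀ - h) - y (x₀ + h))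
        + (h / 3) * (4 * f x₀ * y x₀ + f (x₀ + h) * y (x₀ + h) + f (x₀ - h) * y (x₀ - h))
        - (h ^ 2 / 9) * g x₀ * (f (x₀ - h) * y (x₀ - h) - f (x₀ + h) * y (x₀ + h))
        + (7 * h ^ 5 / 270) * g x₀ * iteratedDeriv 5 y x₀
        + (h ^ 5 / 90) * iteratedDeriv 6 y x₀)
      =O[𝓝 0] (fun h : ℝ => h ^ 7) := by
  have hy' : ContDiffOn ℝ 7 (deriv y) (Set.Ioo lo hi) :=
    hy.deriv_of_isOpen isOpen_Ioo (by norm_num)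
  have hy'' : ContDiffOn ℝ 6 (deriv (deriv y)) (Set.Ioo lo hi) :=
    hy'.deriv_of_isOpen isOpen_Ioo (by norm_num)
  have hy_seven : ContDiffOn ℝ 7 y (Set.Ioo lo hi) := hy.of_le (by norm_num)
  have r₀ := taylor_isBigO_of_contDiffOn_Ioo (n := 7) hx (by exact_mod_cast hy_seven)
  have r₁ := taylor_isBigO_of_contDiffOn_Ioo (n := 7) hx (by exact_mod_cast hy')
  have r₂ := taylor_isBigO_of_contDiffOn_Ioo (n := 6) hx (by exact_mod_cast hy'')
  have hy''_five : ContDiffOn ℝ 5 (deriv (deriv y)) (Set.Ioo lo hi) := hy''.of_le (by norm_num)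
  have r₃ := taylor_isBigO_of_contDiffOn_Ioo (n := 5) hx (by exact_mod_cast hy''_five)
  have s₀ := (r₀.sub (isBigO_pow_comp_neg r₀)).const_mul_left (2 / 3 * g x₀)
  have s₁ := r₁.sub (isBigO_pow_comp_neg r₁)
  have s₂ := (((isBigO_refl (fun h : ℝ => h) _).mul
    (r₂.add (isBigO_pow_comp_neg r₂))).const_mul_left (-1 / 3)).congr_right
      (g₂ := fun h : ℝ => h ^ 7) fun h => by ring
  have s₃ := (((isBigO_refl (fun h : ℝ => h ^ 2) _).mul
    (r₃.sub (isBigO_pow_comp_neg r₃))).const_mul_left (-1 / 9 * g x₀)).congr_right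
      (g₂ := fun h : ℝ => h ^ 7) fun h => by ring
  have near_add : ∀ᶠ h : ℝ in 𝓝 0, x₀ + h ∈ Set.Ioo lo hi :=
    (continuous_const_add x₀).continuousAt.eventually_mem
      (isOpen_Ioo.mem_nhds (by simpa using hx))
  have near_sub : ∀ᶠ h : ℝ in 𝓝 0, x₀ - h ∈ Set.Ioo lo hi :=
    (continuous_sub_left x₀).continuousAt.eventually_mem
      (isOpen_Ioo.mem_nhds (by simpa using hx))
  refine (((s₀.add s₁).add s₂).add s₃).congr' ?_ EventuallyEq.rfl
  filter_upwards [near_add, near_sub] with h hp hm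
  have hderiv (k : ℕ) : iteratedDeriv k (deriv y) x₀ = iteratedDeriv (k + 1) y x₀ := by
    rw [iteratedDeriv_succ']
  have hderiv₂ (k : ℕ) : iteratedDeriv k (deriv (deriv y)) x₀ = iteratedDeriv (k + 2) y x₀ := by
    rw [iteratedDeriv_succ', iteratedDeriv_succ']
  have e₁ : deriv y x₀ = iteratedDeriv 1 y x₀ := by rw [iteratedDeriv_one]
  have e₂ : deriv (deriv y) x₀ = iteratedDeriv 2 y x₀ := by
    rw [iteratedDeriv_succ', iteratedDeriv_one]
  have o₀ := hode x₀ hx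
  rw [e₁, e₂] at o₀
  simp only [Finset.sum_range_succ, Finset.sum_range_zero, hderiv, hderiv₂, Nat.factorial,
    ← sub_eq_add_neg]
  push_cast
  linear_combination (-(h / 3) - h ^ 2 / 9 * g x₀) * hode _ hp
    + (-(h / 3) + h ^ 2 / 9 * g x₀) * hode _ hm - 4 * h / 3 * o₀
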